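/- arXiv:2107.03483 — 6 statements merged into one kernel-verified Lean document; each statement's English description precedes it below -/
import Mathlib

section
/- For every type X, every group-membership map G : X → Bool whose groups A = {x | G x = true} and D = {x | G x = false} are both nonempty, and every non-constant function f : X → Bool, there exists a probability distribution P on X with P(A) > 0 and P(D) > 0 such that the demographic-parity unfairness of f with respect to P equals 1 (in particular DPU_P(f) > 0.9); that is, f can be made arbitrarily DP-unfair by a suitable choice of marginal distribution. -/
/-- The probability of a set `S` under a probability mass function `P`. -/
noncomputable def prob {X : Type*} (P : PMF X) (S : Set X) : ℝ :=
  (P.toOuterMeasure S).toReal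

/-- Conditional probability `P[S | C]`, with the convention that it is `0` when `P C = 0`. -/
noncomputable def condProb {X : Type*} (P : PMF X) (S C : Set X) : ℝ :=
  prob P (S ∩ C) / prob P C

/-- Demographic-parity unfairness of a classifier `h` w.r.t. `P` and groups given by `G`. -/
noncomputable def dpu {X : Type*} (P : PMF X) (G : X → Bool) (h : X → Bool) : ℝ :=
  |condProb P {x | h x = true} {x | G x = true} -
    condProb P {x | h x = true} {x | G x = false}|

/-- The uniform distribution on the (multi)set of two points `a`, `d`. -/
noncomputable def twoPoint {X : Type*} (a d : X) : PMF X :=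
  (PMF.uniformOfFintype Bool).map fun b => if b then a else d

open Classical in
theorem prob_twoPoint {X : Type*} (a d : X) (S : Set X) :
    prob (twoPoint a d) S = ((if a ∈ S then 1 else 0) + (if d ∈ S then 1 else 0)) / 2 := by
  rw [prob, twoPoint, PMF.toOuterMeasure_map_apply, PMF.toOuterMeasure_apply_fintype]
  by_cases ha : a ∈ S <;> by_cases hd : d ∈ S <;>
    simp [Set.indicator, ha, hd, ENNReal.inv_two_add_inv_two]

/-- A non-constant Boolean function takes different values at some two points separated by `G`. -/
theorem exists_ne_across_groups {X : Type*} (G : X → Bool)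
    (hA : {x | G x = true}.Nonempty) (hD : {x | G x = false}.Nonempty)
    (f : X → Bool) (hf : ∃ x y : X, f x ≠ f y) :
    ∃ a d : X, G a = true ∧ G d = false ∧ f a ≠ f d := by
  obtain ⟨a, ha⟩ := hA
  obtain ⟨d, hd⟩ := hD
  obtain ⟨x, y, hxy⟩ := hf
  by_contra! h
  have key : ∀ z, f z = f a := fun z => by
    cases hz : G z
    · exact (h a z ha hz).symm
    · exact (h z d hz hd).trans (h a d ha hd).symm
  exact hxy ((key x).trans (key y).symm)

/-- For every non-constant classifier `f` over a domain with two nonempty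
groups, there is a probability distribution `P` giving positive mass to both groups under
which the demographic-parity unfairness of `f` equals `1`. -/
theorem statement0 {X : Type*} (G : X → Bool)
    (hA : {x | G x = true}.Nonempty) (hD : {x | G x = false}.Nonempty)
    (f : X → Bool) (hf : ∃ x y : X, f x ≠ f y) :
    ∃ P : PMF X,
      0 < prob P {x | G x = true} ∧ 0 < prob P {x | G x = false} ∧
      dpu P G f = 1 := by
  obtain ⟨a, d, ha, hd, hne⟩ := exists_ne_across_groups G hA hD f hf
  refine ⟨twoPoint a d, ?_, ?_, ?_⟩
  · simp [prob_twoPoint, ha, hd]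
  · simp [prob_twoPoint, ha, hd]
  · cases hfa : f a <;> cases hfd : f d <;>
      simp_all [dpu, condProb, prob_twoPoint]
end

section
/- Let X be a type with group-membership map G : X → Bool whose groups A and D are both nonempty, and let F : X → Z be any non-constant representation (i.e., F takes at least two distinct values). Then there exist a classifier h : Z → Bool and a probability distribution P on X with P(A) > 0 and P(D) > 0 such that the demographic-parity unfairness of h ∘ F w.r.t. P equals 1. Consequently, no non-constant representation is adversarially DP-fair with respect to every probability distribution on X. -/
open Classical in
/-- The probability of a set under the uniform distribution on a two-point family. -/
theorem prob_map_uniformOfFintype_bool {X : Type*} (a d : X) (S : Set X) :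
    prob ((PMF.uniformOfFintype Bool).map fun b => cond b a d) S =
      (if a ∈ S then 1 / 2 else 0) + (if d ∈ S then 1 / 2 else 0) := by
  unfold prob
  rw [PMF.toOuterMeasure_map_apply, PMF.toOuterMeasure_apply_fintype]
  by_cases ha : a ∈ S <;> by_cases hd : d ∈ S <;>
    simp [Set.indicator, ha, hd, ENNReal.toReal_add]

/-- A non-constant map separates some pair of points from the two groups. -/
theorem exists_ne_of_nonempty_groups {X Z : Type*} (G : X → Bool)
    (hA : {x | G x = true}.Nonempty) (hD : {x | G x = false}.Nonempty)
    (F : X → Z) (hF : ∃ x y : X, F x ≠ F y) :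
    ∃ a d : X, G a = true ∧ G d = false ∧ F a ≠ F d := by
  obtain ⟨a, ha⟩ := hA
  obtain ⟨d, hd⟩ := hD
  obtain ⟨x, y, hxy⟩ := hF
  by_contra! H
  have key : ∀ z, F z = F a := fun z => by
    cases hz : G z with
    | true => rw [H z d hz hd, H a d ha hd]
    | false => exact (H a z ha hz).symm
  exact hxy ((key x).trans (key y).symm)

/-- For every non-constant representation `F : X → Z` (and nonempty groups),
there exist a classifier `h : Z → Bool` and a distribution `P` giving positive mass to both
groups such that the DP unfairness of `h ∘ F` equals `1`; consequently `F` is not adversarially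
DP-fair with respect to every distribution on `X`. -/
theorem statement1 {X Z : Type*} (G : X → Bool)
    (hA : {x | G x = true}.Nonempty) (hD : {x | G x = false}.Nonempty)
    (F : X → Z) (hF : ∃ x y : X, F x ≠ F y) :
    (∃ (h : Z → Bool) (P : PMF X),
      0 < prob P {x | G x = true} ∧ 0 < prob P {x | G x = false} ∧
      dpu P G (fun x => h (F x)) = 1) ∧
    ¬ (∀ P : PMF X, ∀ h : Z → Bool, dpu P G (fun x => h (F x)) = 0) := by
  classical
  have main : ∃ (h : Z → Bool) (P : PMF X),
      0 < prob P {x | G x = true} ∧ 0 < prob P {x | G x = false} ∧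
      dpu P G (fun x => h (F x)) = 1 := by
    obtain ⟨a, d, ha, hd, hne⟩ := exists_ne_of_nonempty_groups G hA hD F hF
    refine ⟨fun z => decide (z = F a),
      (PMF.uniformOfFintype Bool).map fun b => cond b a d, ?_, ?_, ?_⟩
    · simp [prob_map_uniformOfFintype_bool, ha, hd]
    · simp [prob_map_uniformOfFintype_bool, ha, hd]
    · simp [dpu, condProb, prob_map_uniformOfFintype_bool, ha, hd, hne.symm]
  refine ⟨main, fun H => ?_⟩
  obtain ⟨h, P, -, -, hP⟩ := main
  exact zero_ne_one ((H P h).symm.trans hP)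
end

section
/- There exist a nonempty finite type X, a group-membership map G : X → Bool with both groups nonempty, a ground truth t : X → Bool, a probability distribution P on X, and two features f₁, f₂ : X → Bool such that each single-feature representation is adversarially EO-fair, U_adv(f₁) = 0 and U_adv(f₂) = 0, while the combined representation x ↦ (f₁ x, f₂ x) has maximal adversarial EO unfairness: U_adv(f₁ ⊕ f₂) = 1. -/
/-- The probability of a set `S` under weights `p` on a finite domain. -/
noncomputable def fprob {X : Type*} [Fintype X] (p : X → ℝ) (S : Set X) : ℝ :=
  ∑ x, S.indicator p x

/-- Conditional probability `P[S | C]`, with the convention that it is `0` when `P C = 0`. -/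
noncomputable def fcond {X : Type*} [Fintype X] (p : X → ℝ) (S C : Set X) : ℝ :=
  fprob p (S ∩ C) / fprob p C

/-- False positive rate of classifier `h` on the group `{x | G x = g}`. -/
noncomputable def ffpr {X : Type*} [Fintype X] (p : X → ℝ) (G t : X → Bool) (g : Bool)
    (h : X → Bool) : ℝ :=
  fcond p {x | h x = true} ({x | t x = false} ∩ {x | G x = g})

/-- False negative rate of classifier `h` on the group `{x | G x = g}`. -/
noncomputable def ffnr {X : Type*} [Fintype X] (p : X → ℝ) (G t : X → Bool) (g : Bool)
    (h : X → Bool) : ℝ :=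
  fcond p {x | h x = false} ({x | t x = true} ∩ {x | G x = g})

/-- Equalized-odds unfairness of classifier `h` (group `A` is `{x | G x = true}`,
group `D` is `{x | G x = false}`). -/
noncomputable def feou {X : Type*} [Fintype X] (p : X → ℝ) (G t : X → Bool)
    (h : X → Bool) : ℝ :=
  (1 / 2) * |ffnr p G t true h - ffnr p G t false h| +
    (1 / 2) * |ffpr p G t true h - ffpr p G t false h|

/-- Adversarial EO unfairness of a representation `F`: the maximum EO unfairness over all
classifiers expressible over `F`. -/
noncomputable def uadv {X : Type*} [Fintype X] (p : X → ℝ) (G t : X → Bool) {Z : Type*}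
    (F : X → Z) : ℝ :=
  ⨆ h : Z → Bool, feou p G t (fun x => h (F x))

theorem fprob_nonneg {X : Type*} [Fintype X] {p : X → ℝ} (hp : ∀ x, 0 ≤ p x) (S : Set X) :
    0 ≤ fprob p S :=
  Finset.sum_nonneg fun x _ => Set.indicator_nonneg (fun x _ => hp x) x

theorem fprob_mono {X : Type*} [Fintype X] {p : X → ℝ} (hp : ∀ x, 0 ≤ p x) {S T : Set X}
    (h : S ⊆ T) : fprob p S ≤ fprob p T :=
  Finset.sum_le_sum fun x _ => Set.indicator_le_indicator_of_subset h hp x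

theorem fcond_mem_Icc {X : Type*} [Fintype X] {p : X → ℝ} (hp : ∀ x, 0 ≤ p x) (S C : Set X) :
    fcond p S C ∈ Set.Icc (0 : ℝ) 1 :=
  ⟨div_nonneg (fprob_nonneg hp _) (fprob_nonneg hp _),
    div_le_one_of_le₀ (fprob_mono hp Set.inter_subset_right) (fprob_nonneg hp _)⟩

theorem feou_le_one {X : Type*} [Fintype X] {p : X → ℝ} (hp : ∀ x, 0 ≤ p x) (G t h : X → Bool) :
    feou p G t h ≤ 1 := by
  have hn : |ffnr p G t true h - ffnr p G t false h| ≤ 1 := by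
    simpa [ffnr] using abs_sub_le_of_le_of_le (fcond_mem_Icc hp _ _).1 (fcond_mem_Icc hp _ _).2
      (fcond_mem_Icc hp _ _).1 (fcond_mem_Icc hp _ _).2
  have hf : |ffpr p G t true h - ffpr p G t false h| ≤ 1 := by
    simpa [ffpr] using abs_sub_le_of_le_of_le (fcond_mem_Icc hp _ _).1 (fcond_mem_Icc hp _ _).2
      (fcond_mem_Icc hp _ _).1 (fcond_mem_Icc hp _ _).2
  unfold feou
  linarith

theorem uadv_eq_zero {X Z : Type*} [Fintype X] {p : X → ℝ} {G t : X → Bool} {F : X → Z}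
    (h : ∀ k : Z → Bool, feou p G t (fun x => k (F x)) = 0) : uadv p G t F = 0 := by
  simp [uadv, h]

theorem uadv_eq_one {X Z : Type*} [Fintype X] {p : X → ℝ} (hp : ∀ x, 0 ≤ p x) {G t : X → Bool}
    {F : X → Z} (k : Z → Bool) (h : feou p G t (fun x => k (F x)) = 1) : uadv p G t F = 1 :=
  le_antisymm (ciSup_le fun _ => feou_le_one hp G t _)
    (h ▸ le_ciSup (f := fun k : Z → Bool => feou p G t (fun x => k (F x)))
      ⟨1, Set.forall_mem_range.2 fun _ => feou_le_one hp G t _⟩ k)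

/-- There exist a nonempty finite domain, nonempty groups, a ground truth,
a distribution, and two features, each of which alone is adversarially EO-fair
(`U_adv = 0`), while their combination has maximal adversarial EO unfairness (`U_adv = 1`). -/
theorem statement9 :
    ∃ (X : Type) (inst : Fintype X) (_ : Nonempty X) (G t : X → Bool) (p : X → ℝ)
      (f₁ f₂ : X → Bool),
      letI : Fintype X := inst
      (∀ x, 0 ≤ p x) ∧ (∑ x, p x) = 1 ∧
      {x | G x = true}.Nonempty ∧ {x | G x = false}.Nonempty ∧
      uadv p G t f₁ = 0 ∧ uadv p G t f₂ = 0 ∧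
      uadv p G t (fun x => (f₁ x, f₂ x)) = 1 := by
  have hp : ∀ x : Bool × Bool × Bool, (0 : ℝ) ≤ (fun _ => 1 / 8) x := fun _ => by norm_num
  refine ⟨Bool × Bool × Bool, inferInstance, inferInstance, fun x => xor x.2.1 x.2.2, fun x => x.1,
    fun _ => 1 / 8, fun x => x.2.1, fun x => x.2.2, hp, by simp,
    ⟨(true, true, false), rfl⟩, ⟨(true, true, true), rfl⟩, uadv_eq_zero fun k => ?_,
    uadv_eq_zero fun k => ?_, uadv_eq_one hp (fun z => xor z.1 z.2) ?_⟩
  · cases hT : k true <;> cases hF : k false <;>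
      simp [feou, ffnr, ffpr, fcond, fprob, Fintype.sum_prod_type, Set.indicator_apply, hT, hF]
  · cases hT : k true <;> cases hF : k false <;>
      simp [feou, ffnr, ffpr, fcond, fprob, Fintype.sum_prod_type, Set.indicator_apply, hT, hF]
  · simp [feou, ffnr, ffpr, fcond, fprob, Fintype.sum_prod_type, Set.indicator_apply]
    norm_num
end

section
/- There exist a nonempty finite type X, a group-membership map G : X → Bool with both groups nonempty, a ground truth t : X → Bool, a probability distribution P on X, and two features f₁, f₂ : X → Bool such that: for every α ∈ (0,1) and all ε, η < 1/2, neither the single-feature representation f₁ nor the single-feature representation f₂ is (ε,η)-fairness-enabling w.r.t. (P, t, α); yet the combined representation x ↦ (f₁ x, f₂ x) is (0,0)-fairness-enabling w.r.t. (P, t, α) for every α ∈ (0,1). -/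
/-- The `α`-weighted loss of classifier `h`: `α`-weight on false negatives and `(1-α)` on
false positives. -/
noncomputable def lossA {X : Type*} [Fintype X] (p : X → ℝ) (t : X → Bool) (α : ℝ)
    (h : X → Bool) : ℝ :=
  α * fprob p {x | h x = false ∧ t x = true} +
    (1 - α) * fprob p {x | h x = true ∧ t x = false}

/-- A representation `F` is `(ε, η)`-fairness-enabling w.r.t. `(P, t, α)` if some classifier
expressible over `F` has loss at most `ε` and EO unfairness at most `η`. -/
def FairnessEnabling {X : Type*} [Fintype X] (p : X → ℝ) (G t : X → Bool) (α ε η : ℝ)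
    {Z : Type*} (F : X → Z) : Prop :=
  ∃ h : Z → Bool,
    lossA p t α (fun x => h (F x)) ≤ ε ∧ feou p G t (fun x => h (F x)) ≤ η

/-- With the uniform weights on `Bool × Bool` and both group and ground truth equal to the exclusive
or, a classifier has unfairness `1 / 2` as soon as it is constant or (the negation of) a single
coordinate. -/
theorem feou_xor_comp (f : Bool × Bool → Bool) (hf : f = Prod.fst ∨ f = Prod.snd)
    (h : Bool → Bool) :
    feou (fun _ => 1 / 4) (fun x : Bool × Bool => xor x.1 x.2) (fun x => xor x.1 x.2)
      (fun x => h (f x)) = 1 / 2 := by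
  rcases hf with rfl | rfl <;> cases h0 : h false <;> cases h1 : h true <;>
    norm_num [feou, ffnr, ffpr, fcond, fprob, Fintype.sum_prod_type, Set.indicator, h0, h1]

/-- There exist a nonempty finite domain, nonempty groups, a ground truth,
a distribution, and two features such that for every `α ∈ (0,1)` neither single feature is
`(ε,η)`-fairness-enabling for any `ε, η < 1/2`, while the combination of the two features is
`(0,0)`-fairness-enabling for every `α ∈ (0,1)`. -/
theorem statement12 :
    ∃ (X : Type) (inst : Fintype X) (_ : Nonempty X) (G t : X → Bool) (p : X → ℝ)
      (f₁ f₂ : X → Bool),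
      letI : Fintype X := inst
      (∀ x, 0 ≤ p x) ∧ (∑ x, p x) = 1 ∧
      {x | G x = true}.Nonempty ∧ {x | G x = false}.Nonempty ∧
      (∀ α : ℝ, 0 < α → α < 1 → ∀ ε η : ℝ, ε < 1 / 2 → η < 1 / 2 →
        ¬ FairnessEnabling p G t α ε η f₁ ∧ ¬ FairnessEnabling p G t α ε η f₂) ∧
      (∀ α : ℝ, 0 < α → α < 1 →
        FairnessEnabling p G t α 0 0 (fun x => (f₁ x, f₂ x))) := by
  refine ⟨Bool × Bool, inferInstance, inferInstance, fun x => xor x.1 x.2, fun x => xor x.1 x.2,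
    fun _ => 1 / 4, Prod.fst, Prod.snd, fun _ => by norm_num, by norm_num,
    ⟨(true, false), rfl⟩, ⟨(false, false), rfl⟩, ?_, ?_⟩
  · rintro α - - ε η - hη
    constructor
    · rintro ⟨h, -, hh⟩
      exact absurd (feou_xor_comp _ (.inl rfl) h ▸ hh) (not_le.mpr hη)
    · rintro ⟨h, -, hh⟩
      exact absurd (feou_xor_comp _ (.inr rfl) h ▸ hh) (not_le.mpr hη)
  · intro α _ _
    refine ⟨fun z => xor z.1 z.2, ?_, ?_⟩
    · norm_num [lossA, fprob, Fintype.sum_prod_type, Set.indicator]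
    · norm_num [feou, ffnr, ffpr, fcond, fprob, Fintype.sum_prod_type, Set.indicator]
end

section
/- Let X be a nonempty finite type with group-membership map G : X → Bool and ground truth t : X → Bool such that all four cells X_{g,l} = {x | x ∈ g and t x = l} (g ∈ {A,D}, l ∈ {true,false}) are nonempty. Let f : X → Y (Y finite) be a feature that is non-committing and 2-anonymous. Then there exist a probability distribution P on X and representations F : X → Z and F' : X → Z' such that, for the accuracy-driven EO unfairness at threshold α = 1/2: U_acc^{1/2}(F ⊕ f) < U_acc^{1/2}(F) (deleting f from F ⊕ f increases unfairness) and U_acc^{1/2}(F' ⊕ f) > U_acc^{1/2}(F') (deleting f from F' ⊕ f decreases unfairness). Hence the fairness effect of a single feature cannot be determined without the context of the other available features. -/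
/-- The `α = 1/2` loss of classifier `h`: half the probability of misclassification. -/
noncomputable def lossHalf {X : Type*} [Fintype X] (p : X → ℝ) (t : X → Bool)
    (h : X → Bool) : ℝ :=
  (1 / 2) * fprob p {x | h x ≠ t x}

/-- Accuracy-driven EO unfairness of a representation `F` at threshold `α = 1/2`: the maximum
EO unfairness over all classifiers expressible over `F` that minimize the `1/2`-loss among
classifiers expressible over `F`. -/
noncomputable def uacc {X : Type*} [Fintype X] (p : X → ℝ) (G t : X → Bool) {Z : Type*}
    (F : X → Z) : ℝ :=
  ⨆ h : {h : Z → Bool //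
      ∀ h' : Z → Bool,
        lossHalf p t (fun x => h (F x)) ≤ lossHalf p t (fun x => h' (F x))},
    feou p G t (fun x => h.1 (F x))

/-- The cell `X_{g,l}` of instances with group membership `g` and ground-truth label `l`. -/
def cell {X : Type*} (G t : X → Bool) (g l : Bool) : Set X :=
  {x | G x = g ∧ t x = l}

/-- A feature `f` is non-committing if there are two distinct feature values each of which is
attained in each of the four cells `X_{g,l}`. -/
def NonCommitting {X Y : Type*} (G t : X → Bool) (f : X → Y) : Prop :=
  ∃ y₁ y₂ : Y, y₁ ≠ y₂ ∧ ∀ g l : Bool,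
    (f ⁻¹' {y₁} ∩ cell G t g l).Nonempty ∧ (f ⁻¹' {y₂} ∩ cell G t g l).Nonempty

/-- A feature `f` is `k`-anonymous if for every feature value and every cell `X_{g,l}`, the
set of instances in that cell with that feature value is empty or has at least `k` elements. -/
def KAnonymous {X Y : Type*} (k : ℕ) (G t : X → Bool) (f : X → Y) : Prop :=
  ∀ (y : Y) (g l : Bool),
    f ⁻¹' {y} ∩ cell G t g l = ∅ ∨ k ≤ (f ⁻¹' {y} ∩ cell G t g l).ncard

/-- The uniform weights on four (distinct) points. -/
noncomputable def fourPointWeight {X : Type*} [DecidableEq X] (a b c d : X) : X → ℝ :=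
  Pi.single a (1 / 4) + Pi.single b (1 / 4) + Pi.single c (1 / 4) + Pi.single d (1 / 4)

theorem fprob_fourPointWeight {X : Type*} [Fintype X] [DecidableEq X] (a b c d : X)
    (S : Set X) [DecidablePred (· ∈ S)] :
    fprob (fourPointWeight a b c d) S =
      ((if a ∈ S then 1 else 0) + (if b ∈ S then 1 else 0) + (if c ∈ S then 1 else 0) +
        (if d ∈ S then 1 else 0)) / 4 := by
  have key : ∀ z : X, ∑ x, (if x ∈ S then (Pi.single z (1 / 4 : ℝ) : X → ℝ) x else 0) =
      (if z ∈ S then 1 else 0) / 4 := by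
    intro z
    rw [Finset.sum_eq_single z]
    · split_ifs <;> simp
    · intro x _ hx
      simp [hx]
    · simp
  have hsplit : ∀ x, S.indicator (fourPointWeight a b c d) x =
      (if x ∈ S then (Pi.single a (1 / 4 : ℝ) : X → ℝ) x else 0) +
      (if x ∈ S then (Pi.single b (1 / 4 : ℝ) : X → ℝ) x else 0) +
      (if x ∈ S then (Pi.single c (1 / 4 : ℝ) : X → ℝ) x else 0) +
      (if x ∈ S then (Pi.single d (1 / 4 : ℝ) : X → ℝ) x else 0) := by
    intro x
    by_cases hx : x ∈ S <;> simp [hx, fourPointWeight]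
  simp only [fprob, hsplit, Finset.sum_add_distrib, key]
  ring

theorem fourPointWeight_nonneg {X : Type*} [DecidableEq X] (a b c d : X) :
    0 ≤ fourPointWeight a b c d := by
  have key : ∀ z : X, 0 ≤ (Pi.single z (1 / 4) : X → ℝ) := fun z =>
    Pi.single_nonneg.2 (by norm_num)
  exact add_nonneg (add_nonneg (add_nonneg (key a) (key b)) (key c)) (key d)

theorem sum_fourPointWeight {X : Type*} [Fintype X] [DecidableEq X] (a b c d : X) :
    ∑ x, fourPointWeight a b c d x = 1 := by
  classical
  have h := fprob_fourPointWeight a b c d Set.univ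
  simp only [fprob, Set.indicator_univ, Set.mem_univ, if_true] at h
  rw [h]
  norm_num

section OnePointPerCell

variable {X : Type*} [Fintype X] [DecidableEq X] {G t : X → Bool} {a b c d : X}

theorem lossHalf_fourPointWeight (ha : a ∈ cell G t true true) (hb : b ∈ cell G t true false)
    (hc : c ∈ cell G t false true) (hd : d ∈ cell G t false false) (h : X → Bool) :
    lossHalf (fourPointWeight a b c d) t h =
      ((if h a then 0 else 1) + (if h b then 1 else 0) + (if h c then 0 else 1) +
        (if h d then 1 else 0)) / 8 := by
  classical
  rw [lossHalf, fprob_fourPointWeight]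
  simp only [Set.mem_ofPred_eq, ha.2, hb.2, hc.2, hd.2]
  cases h a <;> cases h b <;> cases h c <;> cases h d <;> norm_num

theorem feou_fourPointWeight (ha : a ∈ cell G t true true) (hb : b ∈ cell G t true false)
    (hc : c ∈ cell G t false true) (hd : d ∈ cell G t false false) (h : X → Bool) :
    feou (fourPointWeight a b c d) G t h =
      (if h a = h c then 0 else 1 / 2) + (if h b = h d then 0 else 1 / 2) := by
  classical
  simp only [feou, ffnr, ffpr, fcond, fprob_fourPointWeight, Set.mem_inter_iff,
    Set.mem_ofPred_eq, ha.1, hb.1, hc.1, hd.1, ha.2, hb.2, hc.2, hd.2]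
  cases h a <;> cases h b <;> cases h c <;> cases h d <;> norm_num

end OnePointPerCell

theorem feou_le_uacc {X Z : Type*} [Fintype X] [Finite Z] {p : X → ℝ} {G t : X → Bool}
    {F : X → Z} (h : Z → Bool)
    (hmin : ∀ h' : Z → Bool,
      lossHalf p t (fun x => h (F x)) ≤ lossHalf p t (fun x => h' (F x))) :
    feou p G t (fun x => h (F x)) ≤ uacc p G t F :=
  le_ciSup (f := fun h : {h : Z → Bool // ∀ h' : Z → Bool,
      lossHalf p t (fun x => h (F x)) ≤ lossHalf p t (fun x => h' (F x))} =>
    feou p G t (fun x => h.1 (F x))) (Set.finite_range _).bddAbove ⟨h, hmin⟩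

/-- For every non-committing, 2-anonymous feature `f` (over a domain whose
four cells are all nonempty), there exist a distribution `P` and representations `F`, `F'`
such that adding `f` to `F` strictly decreases the accuracy-driven EO unfairness at `α = 1/2`
while adding `f` to `F'` strictly increases it. -/
theorem statement13 {X Y : Type*} [Fintype X] [Nonempty X] [Fintype Y]
    (G t : X → Bool)
    (hcells : ∀ g l : Bool, (cell G t g l).Nonempty)
    (f : X → Y) (hnc : NonCommitting G t f) (h2a : KAnonymous 2 G t f) :
    ∃ p : X → ℝ, (∀ x, 0 ≤ p x) ∧ (∑ x, p x) = 1 ∧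
      ∃ (Z Z' : Type) (F : X → Z) (F' : X → Z'),
        uacc p G t (fun x => (F x, f x)) < uacc p G t F ∧
        uacc p G t F' < uacc p G t (fun x => (F' x, f x)) := by
  classical
  obtain ⟨y₁, y₂, hy, hpts⟩ := hnc
  obtain ⟨a, hfa, ha⟩ := (hpts true true).1
  obtain ⟨b, hfb, hb⟩ := (hpts true false).2
  obtain ⟨c, hfc, hc⟩ := (hpts false true).2
  obtain ⟨d, hfd, hd⟩ := (hpts false false).2
  simp only [Set.mem_preimage, Set.mem_singleton_iff] at hfa hfb hfc hfd
  have hy' : y₂ ≠ y₁ := hy.symm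
  have hloss := lossHalf_fourPointWeight ha hb hc hd
  have hfeou := feou_fourPointWeight ha hb hc hd
  refine ⟨fourPointWeight a b c d, fourPointWeight_nonneg a b c d,
    sum_fourPointWeight a b c d, Option Bool, Unit,
    fun x => if G x then none else some (t x), fun _ => (), ?_, ?_⟩
  · refine lt_of_le_of_lt (b := 0) (Real.iSup_le ?_ le_rfl) (lt_of_lt_of_le ?_
      (feou_le_uacc (fun z => z.getD true) ?_))
    · rintro ⟨h, hmin⟩
      have hle := hmin fun z => z.1.getD (decide (z.2 = y₁))
      simp only [hloss, hfeou, ha.1, hb.1, hc.1, hd.1, ha.2, hb.2, hc.2, hd.2, hfa, hfb, hfc,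
        hfd, reduceIte, Bool.false_eq_true] at hle ⊢
      revert hle
      cases h (none, y₁) <;> cases h (none, y₂) <;> cases h (some true, y₂) <;>
        cases h (some false, y₂) <;> simp [hy'] <;> norm_num
    · simp [hfeou, ha.1, hb.1, hc.1, hd.1, hc.2, hd.2]
    · intro h
      simp only [hloss, ha.1, hb.1, hc.1, hd.1, hc.2, hd.2, reduceIte, Bool.false_eq_true]
      cases h none <;> cases h (some true) <;> cases h (some false) <;> simp <;> norm_num
  · refine lt_of_le_of_lt (b := 0) (Real.iSup_le ?_ le_rfl) (lt_of_lt_of_le ?_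
      (feou_le_uacc (fun z => decide (z.2 = y₁)) ?_))
    · rintro ⟨h, -⟩
      simp [hfeou]
    · simp [hfeou, hfa, hfb, hfc, hfd, hy']
    · intro h
      simp only [hloss, hfa, hfb, hfc, hfd]
      cases h ((), y₁) <;> cases h ((), y₂) <;> simp [hy'] <;> norm_num
end

section
/- Let X be a nonempty finite type with group-membership map G : X → Bool and ground truth t : X → Bool such that all four cells X_{g,l} = {x | x ∈ g and t x = l} (g ∈ {A,D}, l ∈ {true,false}) are nonempty. For every feature f : X → Y (Y finite) that is non-committing and 2-anonymous, there exists a probability distribution P on X such that the pair (f, P) is generic. -/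
/-- A feature–distribution pair `(f, p)` is generic: there are a label `l₁` (with opposite
`!l₁`), a group `g₁` (with opposite `!g₁`, where `true` codes group `A`), and sets
`C₁, C₂, C₃ ⊆ X` satisfying the six conditions of Definition `generic`. -/
def Generic {X Y : Type*} [Fintype X] (p : X → ℝ) (G t : X → Bool) (f : X → Y) : Prop :=
  ∃ (l₁ g₁ : Bool) (C₁ C₂ C₃ : Set X),
    (fprob p C₂ < fprob p C₁ ∧ 0 < fprob p C₂) ∧
    (∃ y₁ y₂ : Y, y₁ ≠ y₂ ∧ C₁ ⊆ f ⁻¹' {y₁} ∧ C₂ ⊆ f ⁻¹' {y₂}) ∧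
    (C₁ ⊆ {x | t x = l₁} ∧ C₂ ⊆ cell G t g₁ (!l₁)) ∧
    (∃ y₃ : Y, C₃ ⊆ f ⁻¹' {y₃}) ∧
    fprob p ({x | t x = !l₁} ∩ C₃) ≤ fprob p ({x | t x = l₁} ∩ C₃) ∧
    fprob p ((C₂ ∪ C₃) ∩ cell G t g₁ (!l₁)) / fprob p (cell G t g₁ (!l₁)) ≤
      fprob p (C₃ ∩ cell G t (!g₁) (!l₁)) / fprob p (cell G t (!g₁) (!l₁))

open Classical in
/-- Probability of a set under weights supported on three points. -/
theorem fprob_three_single {X : Type*} [Fintype X] (a b d : X) (u v w : ℝ) (S : Set X) :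
    fprob (Pi.single a u + Pi.single b v + Pi.single d w) S =
      (if a ∈ S then u else 0) + (if b ∈ S then v else 0) + (if d ∈ S then w else 0) := by
  have single (c : X) (r : ℝ) :
      ∑ x, S.indicator (Pi.single c r : X → ℝ) x = if c ∈ S then r else 0 := by
    rw [Finset.sum_eq_single c]
    · simp [Set.indicator_apply]
    · intro x _ hx
      simp [Set.indicator_apply, hx]
    · simp
  simp only [fprob, Set.indicator_add', Pi.add_apply, Finset.sum_add_distrib, single]

/-- For every non-committing, 2-anonymous feature `f` over a domain whose
four cells are all nonempty, there exists a probability distribution `P` such that the pair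
`(f, P)` is generic. -/
theorem statement15 {X Y : Type*} [Fintype X] [Nonempty X] [Fintype Y]
    (G t : X → Bool)
    (hcells : ∀ g l : Bool, (cell G t g l).Nonempty)
    (f : X → Y) (hnc : NonCommitting G t f) (h2a : KAnonymous 2 G t f) :
    ∃ p : X → ℝ, (∀ x, 0 ≤ p x) ∧ (∑ x, p x) = 1 ∧ Generic p G t f := by
  classical
  obtain ⟨y₁, y₂, hy, hne⟩ := hnc
  obtain ⟨a, hfa, hGa, hta⟩ := (hne true true).1
  obtain ⟨b, hfb, hGb, htb⟩ := (hne true false).2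
  obtain ⟨d, hfd, hGd, htd⟩ := (hne false false).1
  simp only [Set.mem_preimage, Set.mem_singleton_iff] at hfa hfb hfd
  have hba : b ≠ a := by rintro rfl; simp_all
  have hda : d ≠ a := by rintro rfl; simp_all
  have hbd : b ≠ d := by rintro rfl; simp_all
  refine ⟨Pi.single a (1 / 2) + Pi.single b (1 / 4) + Pi.single d (1 / 4), fun x => ?_, ?_,
    true, true, {a}, {b}, {a, d}, ?_, ⟨y₁, y₂, hy, ?_, ?_⟩, ⟨?_, ?_⟩, ⟨y₁, ?_⟩, ?_, ?_⟩
  · simp only [Pi.add_apply, Pi.single_apply]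
    positivity
  · simp only [Pi.add_apply, Finset.sum_add_distrib, Finset.sum_pi_single', Finset.mem_univ]
    norm_num
  · simp only [fprob_three_single, Set.mem_singleton_iff, hba, hba.symm, hda, hbd.symm]
    norm_num
  · simpa using hfa
  · simpa using hfb
  · simpa using hta
  · simpa [cell] using And.intro hGb htb
  · simp [Set.insert_subset_iff, hfa, hfd]
  · simp [fprob_three_single, hta, htb, htd, hba, hbd]
    norm_num
  · simp [fprob_three_single, cell, hGa, hGb, hGd, hta, htb, htd]
end
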